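/- Let n ≥ 2. For every integer i ≥ 2, the homogeneous component W(n)_{[i]} is contained in the F-linear span of the brackets [A,B] with A ∈ W(n)_{[i−1]} and B ∈ W(n)_{[1]}. -/

import Mathlib

open MvPolynomial

noncomputable section

abbrev Wn (F : Type*) [Field F] (n : ℕ) :=
  Derivation F (MvPolynomial (Fin n) F) (MvPolynomial (Fin n) F)

/-- The submodule of polynomials homogeneous of integer degree `d`
(for `d < 0` this is `⊥`). -/
def homZ (F : Type*) [Field F] (n : ℕ) (d : ℤ) : Submodule F (MvPolynomial (Fin n) F) where
  carrier := {p | ∀ m : Fin n →₀ ℕ, coeff m p ≠ 0 → (m.sum fun _ e => (e : ℤ)) = d}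
  zero_mem' := by intro m hm; simp at hm
  add_mem' := by
    intro p q hp hq m hm
    by_cases h : coeff m p = 0
    · refine hq m fun hq0 => hm ?_
      simp [coeff_add, h, hq0]
    · exact hp m h
  smul_mem' := by
    intro c p hp m hm
    refine hp m fun h => hm ?_
    simp [coeff_smul, h]

/-- The homogeneous component `W(n)_{[i]}`. -/
def Wgr (F : Type*) [Field F] (n : ℕ) (i : ℤ) : Submodule F (Wn F n) where
  carrier := {D | ∀ k, D (X k) ∈ homZ F n (i + 1)}
  zero_mem' := by intro k; simp
  add_mem' := by intro D E hD hE k; simpa using add_mem (hD k) (hE k)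
  smul_mem' := by intro c D hD k; simpa using Submodule.smul_mem _ c (hD k)


theorem mem_homZ_of_isHomogeneous {F : Type*} [Field F] {n d : ℕ} {e : ℤ}
    {p : MvPolynomial (Fin n) F} (hp : p.IsHomogeneous d) (hde : (d : ℤ) = e) :
    p ∈ homZ F n e := by
  intro m hm
  have h := hp.degree_eq_sum_deg_support (mem_support_iff.2 hm)
  rw [← hde, h]
  simp [Finsupp.sum]

theorem smul_pderiv_mem_Wgr {F : Type*} [Field F] {n d : ℕ} {i : ℤ}
    {p : MvPolynomial (Fin n) F} (hp : p.IsHomogeneous d) (hdi : (d : ℤ) = i + 1) (k : Fin n) :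
    (p • pderiv k : Wn F n) ∈ Wgr F n i := by
  intro j
  by_cases hjk : j = k
  · subst hjk
    simpa using mem_homZ_of_isHomogeneous hp hdi
  · simp [pderiv_X_of_ne hjk]

theorem lie_smul_pderiv {F : Type*} [Field F] {n : ℕ} (f g : MvPolynomial (Fin n) F)
    (p q : Fin n) :
    ⁅(f • pderiv p : Wn F n), (g • pderiv q : Wn F n)⁆ =
      ((f * pderiv p g) • pderiv q - (g * pderiv q f) • pderiv p : Wn F n) := by
  apply MvPolynomial.derivation_ext
  intro j
  have h (a b : Fin n) : pderiv a (pderiv b (X j : MvPolynomial (Fin n) F)) = 0 := by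
    by_cases hjb : j = b
    · subst hjb; simp
    · simp [pderiv_X_of_ne hjb]
  simp only [Derivation.commutator_apply, Derivation.sub_apply, Derivation.smul_apply, smul_eq_mul,
    Derivation.leibniz, h]
  ring

theorem sub_smul_derivation {F : Type*} [Field F] {n : ℕ} (f g : MvPolynomial (Fin n) F)
    (D : Wn F n) : f • D - g • D = (f - g) • D := by
  ext1 j
  simp [sub_mul]

theorem eq_single_or_exists_eq_add_single {n : ℕ} (k : Fin n) (α : Fin n →₀ ℕ) :
    α = Finsupp.single k (α k) ∨
      ∃ l, l ≠ k ∧ ∃ β, α = β + Finsupp.single l 1 := by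
  by_cases h : ∃ l, l ≠ k ∧ α l ≠ 0
  · obtain ⟨l, hlk, hl⟩ := h
    refine Or.inr ⟨l, hlk, α - Finsupp.single l 1, (tsub_add_cancel_of_le ?_).symm⟩
    simpa [Nat.one_le_iff_ne_zero] using hl
  · push Not at h
    left
    ext j
    by_cases hj : j = k
    · subst hj; simp
    · simp [h j hj, Finsupp.single_eq_of_ne hj]

/-- The span of the brackets of `W(n)_{[i-1]}` with `W(n)_{[1]}`. -/
def bracketSpan (F : Type*) [Field F] (n : ℕ) (i : ℤ) : Submodule F (Wn F n) :=
  Submodule.span F {Z : Wn F n | ∃ A ∈ Wgr F n (i - 1), ∃ B ∈ Wgr F n 1, Z = ⁅A, B⁆}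

theorem lie_smul_pderiv_mem_bracketSpan {F : Type*} [Field F] {n d : ℕ} {i : ℤ}
    {f g : MvPolynomial (Fin n) F} (hf : f.IsHomogeneous d) (hdi : (d : ℤ) = i)
    (hg : g.IsHomogeneous 2) (p q : Fin n) :
    ((f * pderiv p g) • pderiv q - (g * pderiv q f) • pderiv p : Wn F n) ∈ bracketSpan F n i := by
  rw [← lie_smul_pderiv]
  exact Submodule.subset_span ⟨_, smul_pderiv_mem_Wgr hf (by simpa using hdi) p, _,
    smul_pderiv_mem_Wgr hg (by norm_num) q, rfl⟩

theorem pderiv_monomial_mul_X_self {F : Type*} [Field F] {n : ℕ} (β : Fin n →₀ ℕ) (k : Fin n) :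
    pderiv k (monomial β (1 : F) * X k) = ((β k : F) + 1) • monomial β (1 : F) := by
  rw [Derivation.leibniz, pderiv_X_self, smul_eq_mul, smul_eq_mul, X_mul_pderiv_monomial,
    add_smul, one_smul, mul_one, add_comm, Nat.cast_smul_eq_nsmul]

/-- A field `x^β x_l x_m ∂_k` with `l, m ≠ k` is a multiple of
`[x^β x_k ∂_k, x_l x_m ∂_k]`. -/
theorem monomial_mul_X_mul_X_smul_pderiv_mem {F : Type*} [Field F] [CharZero F] {n : ℕ} {i : ℤ}
    {β : Fin n →₀ ℕ} (hβ : (β.degree : ℤ) + 1 = i) {k l m : Fin n} (hl : l ≠ k) (hm : m ≠ k) :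
    ((monomial β (1 : F) * X m * X l) • pderiv k : Wn F n) ∈ bracketSpan F n i := by
  have h := lie_smul_pderiv_mem_bracketSpan (i := i)
    ((isHomogeneous_monomial (1 : F) (d := β) rfl).mul (isHomogeneous_X F k))
    (by exact_mod_cast hβ) ((isHomogeneous_X F m).mul (isHomogeneous_X F l)) k k
  have h0 : pderiv k (X m * X l : MvPolynomial (Fin n) F) = 0 := by
    simp [Derivation.leibniz, pderiv_X_of_ne hl, pderiv_X_of_ne hm]
  rw [h0, pderiv_monomial_mul_X_self, mul_zero, zero_smul, zero_sub, neg_mem_iff,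
    mul_smul_comm, smul_assoc] at h
  have hc : (β k : F) + 1 ≠ 0 := Nat.cast_add_one_ne_zero _
  rw [Submodule.smul_mem_iff _ hc] at h
  convert h using 2
  ring

/-- The field `x_k^{d+2} x_l ∂_k` is a multiple of `[x_k^{d+2} ∂_k, x_k x_l ∂_k]`. -/
theorem X_pow_mul_X_smul_pderiv_mem {F : Type*} [Field F] [CharZero F] {n : ℕ} (d : ℕ)
    {k l : Fin n} (hl : l ≠ k) :
    ((X k ^ (d + 2) * X l : MvPolynomial (Fin n) F) • pderiv k : Wn F n) ∈
      bracketSpan F n (d + 2) := by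
  have h := lie_smul_pderiv_mem_bracketSpan (i := d + 2)
    (isHomogeneous_X_pow (R := F) k (d + 2)) (by simp)
    ((isHomogeneous_X F k).mul (isHomogeneous_X F l)) k k
  rw [sub_smul_derivation] at h
  have hc : -((d : F) + 1) ≠ 0 := neg_ne_zero.2 (Nat.cast_add_one_ne_zero d)
  rw [← Submodule.smul_mem_iff _ hc, ← smul_assoc]
  convert h using 2
  simp only [Derivation.leibniz, Derivation.leibniz_pow, pderiv_X_self, pderiv_X_of_ne hl,
    smul_eq_mul, nsmul_eq_mul, smul_eq_C_mul, map_neg, map_add, map_one, map_natCast]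
  push_cast
  ring

/-- The field `x_k^{d+3} ∂_k` equals
`[x_k^{d+2} ∂_l, x_k x_l ∂_k]` up to a multiple of `x_k^{d+2} x_l ∂_l`. -/
theorem X_pow_smul_pderiv_mem {F : Type*} [Field F] [CharZero F] {n : ℕ} (d : ℕ)
    {k l : Fin n} (hl : l ≠ k) :
    ((X k ^ (d + 3) : MvPolynomial (Fin n) F) • pderiv k : Wn F n) ∈
      bracketSpan F n (d + 2) := by
  have h := lie_smul_pderiv_mem_bracketSpan (i := d + 2)
    (isHomogeneous_X_pow (R := F) k (d + 2)) (by simp)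
    ((isHomogeneous_X F k).mul (isHomogeneous_X F l)) l k
  have h' := monomial_mul_X_mul_X_smul_pderiv_mem (F := F) (i := d + 2)
    (β := Finsupp.single k d + Finsupp.single l 1) (by simp; ring) hl.symm hl.symm
  have h'' := add_mem h (Submodule.smul_mem _ ((d : F) + 2) h')
  convert h'' using 1
  rw [← smul_assoc, sub_add, sub_smul_derivation]
  have e1 : (X k ^ (d + 2) * pderiv l (X k * X l) : MvPolynomial (Fin n) F) = X k ^ (d + 3) := by
    simp only [Derivation.leibniz, pderiv_X_self, pderiv_X_of_ne hl.symm, smul_eq_mul]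
    ring
  have e2 : (X k * X l * pderiv k (X k ^ (d + 2)) -
      ((d : F) + 2) • (monomial (Finsupp.single k d + Finsupp.single l 1) (1 : F) * X k * X k) :
      MvPolynomial (Fin n) F) = 0 := by
    have : monomial (Finsupp.single k d + Finsupp.single l 1) (1 : F) = X k ^ d * X l := by
      rw [X_pow_eq_monomial, X, monomial_mul, one_mul]
    rw [this]
    simp only [Derivation.leibniz_pow, pderiv_X_self, smul_eq_mul, nsmul_eq_mul, smul_eq_C_mul,
      map_add, map_natCast, map_ofNat]
    push_cast
    ring
  rw [e1, e2, zero_smul, sub_zero]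

theorem monomial_smul_pderiv_mem {F : Type*} [Field F] [CharZero F] {n : ℕ} (hn : 2 ≤ n) (d : ℕ)
    {α : Fin n →₀ ℕ} (hα : α.degree = d + 3) (k : Fin n) :
    (monomial α (1 : F) • pderiv k : Wn F n) ∈ bracketSpan F n (d + 2) := by
  rcases eq_single_or_exists_eq_add_single k α with h | ⟨l, hl, β, rfl⟩
  · have : Nontrivial (Fin n) := Fin.nontrivial_iff_two_le.2 hn
    obtain ⟨l, hl⟩ := exists_ne k
    rw [h, Finsupp.degree_single] at hα
    rw [h, hα, ← X_pow_eq_monomial]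
    exact X_pow_smul_pderiv_mem d hl
  rw [map_add, Finsupp.degree_single] at hα
  have hs (γ : Fin n →₀ ℕ) (j : Fin n) :
      monomial (γ + Finsupp.single j 1) (1 : F) = monomial γ 1 * X j := by
    rw [X, monomial_mul, one_mul]
  rw [hs]
  rcases eq_single_or_exists_eq_add_single k β with h | ⟨m, hm, γ, rfl⟩
  · rw [h, Finsupp.degree_single] at hα
    rw [h, show β k = d + 2 by lia, ← X_pow_eq_monomial]
    exact X_pow_mul_X_smul_pderiv_mem d hl
  · rw [map_add, Finsupp.degree_single] at hα
    rw [hs]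
    exact monomial_mul_X_mul_X_smul_pderiv_mem (by lia) hl hm

/-- for `n ≥ 2` and `i ≥ 2`, the component `W(n)_{[i]}` is
contained in the span of the brackets `[A, B]` with `A ∈ W(n)_{[i−1]}`,
`B ∈ W(n)_{[1]}`. -/
theorem stmt7 (F : Type*) [Field F] [CharZero F] (n : ℕ) (hn : 2 ≤ n) :
    ∀ i : ℤ, 2 ≤ i →
      (Wgr F n i : Set (Wn F n)) ⊆
        ↑(Submodule.span F {Z : Wn F n |
          ∃ A ∈ Wgr F n (i - 1), ∃ B ∈ Wgr F n 1, Z = ⁅A, B⁆}) := by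
  intro i hi D hD
  obtain ⟨d, rfl⟩ : ∃ d : ℕ, i = d + 2 := ⟨(i - 2).toNat, by lia⟩
  change D ∈ bracketSpan F n (d + 2)
  have hsum : D = ∑ k, D (X k) • (pderiv k : Wn F n) := by
    apply MvPolynomial.derivation_ext
    intro j
    rw [← Derivation.coeFnAddMonoidHom_apply (∑ k, _), map_sum, Finset.sum_apply]
    simp [pderiv_X, Pi.single_apply]
  rw [hsum]
  refine sum_mem fun k _ => ?_
  rw [(D (X k)).as_sum, Finset.sum_smul]
  refine sum_mem fun α hα => ?_
  have hdeg := hD k α (mem_support_iff.1 hα)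
  rw [← mul_one (coeff α (D (X k))), ← smul_eq_mul, ← smul_monomial, smul_assoc]
  refine Submodule.smul_mem _ _ (monomial_smul_pderiv_mem hn d ?_ k)
  have : ((α.degree : ℕ) : ℤ) = d + 2 + 1 := by
    rw [← hdeg]
    simp [Finsupp.sum, Finsupp.degree_apply]
  lia
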